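/- arXiv:1201.2198 — 3 statements merged into one kernel-verified Lean document; each statement's English description precedes it below -/
import Mathlib

section
/- In the overlap array setup, suppose μ satisfies the Ghirlanda–Guerra identities for system 1. Then for every n ≥ 1 and all Borel sets A ⊆ [−1,1], A₁ ⊆ [0,1], A₂ ⊆ [0,1], one has μ(C_n) ≥ μ₁(A₁) · μ(B_n). -/
open MeasureTheory

namespace OverlapArray

/-- The space `([-1,1]^{ℕ×ℕ})³` of triples of overlap arrays
`((R¹_{l,l'}), (R²_{l,l'}), (R_{l,l'}))` (realized inside `(ℝ^{ℕ×ℕ})³`, the constraint that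
entries lie in `[-1,1]` being imposed almost surely). -/
abbrev OA : Type := (ℕ → ℕ → ℝ) × (ℕ → ℕ → ℝ) × (ℕ → ℕ → ℝ)

/-- The overlap array `(R¹_{l,l'})` of the first system. -/
def R1 (ω : OA) : ℕ → ℕ → ℝ := ω.1

/-- The overlap array `(R²_{l,l'})` of the second system. -/
def R2 (ω : OA) : ℕ → ℕ → ℝ := ω.2.1

/-- The array `(R_{l,l'})` of cross overlaps. -/
def R (ω : OA) : ℕ → ℕ → ℝ := ω.2.2

/-- Relabelling the replicas of the first system by `π` and of the second system by `π'`. -/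
def permMap (π π' : Equiv.Perm ℕ) (ω : OA) : OA :=
  (fun l l' => R1 ω (π l) (π l'), fun l l' => R2 ω (π' l) (π' l'),
   fun l l' => R ω (π l) (π' l'))

/-- The overlap array setup: `μ` is a probability measure on `OA` with entries a.s. in
`[-1,1]`, `R¹, R²` a.s. symmetric with unit diagonal, and `μ` invariant under finitely
supported permutations of the replicas of each system. -/
structure Setup (μ : Measure OA) : Prop where
  prob : IsProbabilityMeasure μ
  bounded : ∀ᵐ ω ∂μ, ∀ l l', |R1 ω l l'| ≤ 1 ∧ |R2 ω l l'| ≤ 1 ∧ |R ω l l'| ≤ 1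
  symm : ∀ᵐ ω ∂μ, ∀ l l', R1 ω l l' = R1 ω l' l ∧ R2 ω l l' = R2 ω l' l
  diag : ∀ᵐ ω ∂μ, ∀ l, R1 ω l l = 1 ∧ R2 ω l l = 1
  exch : ∀ π π' : Equiv.Perm ℕ, {x | π x ≠ x}.Finite → {x | π' x ≠ x}.Finite →
    μ.map (permMap π π') = μ

/-- Evaluation of a function `f` of the overlaps on the first `n` replicas. -/
def fRep (n : ℕ)
    (f : ((Fin n → Fin n → ℝ) × (Fin n → Fin n → ℝ) × (Fin n → Fin n → ℝ)) → ℝ)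
    (ω : OA) : ℝ :=
  f (fun l l' => R1 ω l.val l'.val, fun l l' => R2 ω l.val l'.val,
     fun l l' => R ω l.val l'.val)

/-- The Ghirlanda–Guerra identities for system 1: for every `n ≥ 1`, every bounded
measurable function `f` of the overlaps on `n` replicas and every bounded Borel even
`ψ : [-1,1] → ℝ`,
`E[f·ψ(R¹_{1,n+1})] = (1/n) E[f]·E[ψ(R¹_{1,2})] + (1/n) ∑_{l=2}^n E[f·ψ(R¹_{1,l})]`
(replicas are indexed from `0` here, so `R¹_{1,l}` is `R1 ω 0 (l-1)`). -/
def GG1 (μ : Measure OA) : Prop :=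
  ∀ n : ℕ, 1 ≤ n →
  ∀ f : ((Fin n → Fin n → ℝ) × (Fin n → Fin n → ℝ) × (Fin n → Fin n → ℝ)) → ℝ,
    Measurable f → (∃ C, ∀ v, |f v| ≤ C) →
  ∀ ψ : ℝ → ℝ, Measurable ψ → (∃ C, ∀ x, |ψ x| ≤ C) → (∀ x, ψ (-x) = ψ x) →
    ∫ ω, fRep n f ω * ψ (R1 ω 0 n) ∂μ
      = (1 / n) * (∫ ω, fRep n f ω ∂μ) * (∫ ω, ψ (R1 ω 0 1) ∂μ)
        + (1 / n) * ∑ l ∈ Finset.Ico 1 n, ∫ ω, fRep n f ω * ψ (R1 ω 0 l) ∂μ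

/-- The Ghirlanda–Guerra identities for system 2. -/
def GG2 (μ : Measure OA) : Prop :=
  ∀ n : ℕ, 1 ≤ n →
  ∀ f : ((Fin n → Fin n → ℝ) × (Fin n → Fin n → ℝ) × (Fin n → Fin n → ℝ)) → ℝ,
    Measurable f → (∃ C, ∀ v, |f v| ≤ C) →
  ∀ ψ : ℝ → ℝ, Measurable ψ → (∃ C, ∀ x, |ψ x| ≤ C) → (∀ x, ψ (-x) = ψ x) →
    ∫ ω, fRep n f ω * ψ (R2 ω 0 n) ∂μ
      = (1 / n) * (∫ ω, fRep n f ω ∂μ) * (∫ ω, ψ (R2 ω 0 1) ∂μ)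
        + (1 / n) * ∑ l ∈ Finset.Ico 1 n, ∫ ω, fRep n f ω * ψ (R2 ω 0 l) ∂μ

/-- The event `{R_{1,1} ∈ A}`. -/
def EA (A : Set ℝ) : Set OA := {ω | R ω 0 0 ∈ A}

/-- The event `{|R¹_{l,l'}| ∈ A₁ for all l ≠ l' ≤ n}` (with `0`-based replica indices). -/
def E1 (n : ℕ) (A1 : Set ℝ) : Set OA :=
  {ω | ∀ l l', l < n → l' < n → l ≠ l' → |R1 ω l l'| ∈ A1}

/-- The event `{|R²_{l,l'}| ∈ A₂ for all l ≠ l' ≤ n}` (with `0`-based replica indices). -/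
def E2 (n : ℕ) (A2 : Set ℝ) : Set OA :=
  {ω | ∀ l l', l < n → l' < n → l ≠ l' → |R2 ω l l'| ∈ A2}

/-- The event `B_n`. -/
def Bev (n : ℕ) (A A1 A2 : Set ℝ) : Set OA := EA A ∩ E1 n A1 ∩ E2 n A2

/-- The event `C_n`. -/
def Cev (n : ℕ) (A A1 A2 : Set ℝ) : Set OA := EA A ∩ E1 (n + 1) A1 ∩ E2 n A2

end OverlapArray

open OverlapArray

namespace OverlapArray

lemma meas_R1 (i j : ℕ) : Measurable (fun ω : OA => R1 ω i j) := by
  unfold R1; fun_prop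

lemma meas_R2 (i j : ℕ) : Measurable (fun ω : OA => R2 ω i j) := by
  unfold R2; fun_prop

lemma meas_R (i j : ℕ) : Measurable (fun ω : OA => R ω i j) := by
  unfold R; fun_prop

/-- `B_n` with `R_{1,1}` replaced by `R_{l,1}`. -/
def Bl (l n : ℕ) (A A1 A2 : Set ℝ) : Set OA := {ω | R ω l 0 ∈ A} ∩ E1 n A1 ∩ E2 n A2

lemma meas_Bl (l n : ℕ) {A A1 A2 : Set ℝ} (hA : MeasurableSet A) (hA1 : MeasurableSet A1)
    (hA2 : MeasurableSet A2) : MeasurableSet (Bl l n A A1 A2) := by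
  refine ((meas_R l 0 hA).inter ?_).inter ?_
  · unfold E1
    simp only [Set.setOf_forall]
    refine MeasurableSet.iInter fun i => MeasurableSet.iInter fun j =>
      MeasurableSet.iInter fun _ => MeasurableSet.iInter fun _ => MeasurableSet.iInter fun _ => ?_
    exact (continuous_abs.measurable.comp (meas_R1 i j)) hA1
  · unfold E2
    simp only [Set.setOf_forall]
    refine MeasurableSet.iInter fun i => MeasurableSet.iInter fun j =>
      MeasurableSet.iInter fun _ => MeasurableSet.iInter fun _ => MeasurableSet.iInter fun _ => ?_
    exact (continuous_abs.measurable.comp (meas_R2 i j)) hA2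

/-- The Ghirlanda–Guerra identity applied to `Bl` and the complement of `A1`. -/
lemma gg_Bl (μ : Measure OA) (hsetup : Setup μ) (hGG : GG1 μ)
    (n : ℕ) (l : ℕ) (hl : l < n) (A A1 A2 : Set ℝ)
    (hA : MeasurableSet A) (hA1 : MeasurableSet A1) (hA2 : MeasurableSet A2) :
    μ.real (Bl l n A A1 A2 ∩ {ω | |R1 ω 0 n| ∉ A1})
      = (1 / n) * μ.real (Bl l n A A1 A2) * μ.real {ω | |R1 ω 0 1| ∉ A1} := by
  classical
  have hn : 1 ≤ n := by omega
  let S : Set ((Fin n → Fin n → ℝ) × (Fin n → Fin n → ℝ) × (Fin n → Fin n → ℝ)) :=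
    {v | v.2.2 ⟨l, hl⟩ ⟨0, hn⟩ ∈ A} ∩ {v | ∀ i j, i ≠ j → |v.1 i j| ∈ A1}
      ∩ {v | ∀ i j, i ≠ j → |v.2.1 i j| ∈ A2}
  have hS : MeasurableSet S := by
    refine (MeasurableSet.inter ?_ ?_).inter ?_
    · exact measurableSet_preimage (by fun_prop) hA
    · simp only [Set.setOf_forall]
      refine MeasurableSet.iInter fun i => MeasurableSet.iInter fun j =>
        MeasurableSet.iInter fun _ => ?_
      exact measurableSet_preimage (f := fun v : ((Fin n → Fin n → ℝ) × (Fin n → Fin n → ℝ) × (Fin n → Fin n → ℝ)) => |v.1 i j|)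
        (continuous_abs.measurable.comp (by fun_prop)) hA1
    · simp only [Set.setOf_forall]
      refine MeasurableSet.iInter fun i => MeasurableSet.iInter fun j =>
        MeasurableSet.iInter fun _ => ?_
      exact measurableSet_preimage (f := fun v : ((Fin n → Fin n → ℝ) × (Fin n → Fin n → ℝ) × (Fin n → Fin n → ℝ)) => |v.2.1 i j|)
        (continuous_abs.measurable.comp (by fun_prop)) hA2
  have hT : MeasurableSet {x : ℝ | |x| ∉ A1} := (continuous_abs.measurable hA1).compl
  have key := hGG n hn (S.indicator 1) (measurable_one.indicator hS)
    ⟨1, fun v => by by_cases h : v ∈ S <;> simp [h]⟩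
    ({x : ℝ | |x| ∉ A1}.indicator 1) (measurable_one.indicator hT)
    ⟨1, fun v => by by_cases h : |v| ∈ A1 <;> simp [Set.indicator, h]⟩
    (fun x => by simp [Set.indicator])
  have hf : fRep n (S.indicator 1) = (Bl l n A A1 A2).indicator 1 := by
    funext ω
    unfold fRep
    have : ((fun l l' => R1 ω l.val l'.val, fun l l' => R2 ω l.val l'.val,
       fun l l' => R ω l.val l'.val) ∈ S) ↔ ω ∈ Bl l n A A1 A2 := by
      simp only [S, Bl, E1, E2, Set.mem_inter_iff, Set.mem_setOf_eq, Fin.forall_iff, ne_eq,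
        Fin.mk.injEq]
      grind
    by_cases h : ω ∈ Bl l n A A1 A2
    · rw [Set.indicator_of_mem h, Set.indicator_of_mem (this.2 h)]; rfl
    · rw [Set.indicator_of_notMem h, Set.indicator_of_notMem (fun h' => h (this.1 h'))]
  have hB := meas_Bl l n hA hA1 hA2
  have hTm : ∀ j, MeasurableSet {ω : OA | |R1 ω 0 j| ∉ A1} := fun j => meas_R1 0 j hT
  have hprod : ∀ j, ∫ ω, fRep n (S.indicator 1) ω * ({x : ℝ | |x| ∉ A1}.indicator 1) (R1 ω 0 j) ∂μ
      = μ.real (Bl l n A A1 A2 ∩ {ω | |R1 ω 0 j| ∉ A1}) := by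
    intro j
    rw [← integral_indicator_one (hB.inter (hTm j)), hf]
    congr 1
    funext ω
    by_cases h : ω ∈ Bl l n A A1 A2 <;> by_cases h' : |R1 ω 0 j| ∈ A1 <;>
      simp [Set.indicator, h, h']
  simp only [hprod] at key
  rw [hf, integral_indicator_one hB] at key
  have h1 : ∫ ω, ({x : ℝ | |x| ∉ A1}.indicator 1) (R1 ω 0 1) ∂μ
      = μ.real {ω | |R1 ω 0 1| ∉ A1} := by
    rw [← integral_indicator_one (hTm 1)]
    rfl
  rw [h1] at key
  have h0 : ∑ j ∈ Finset.Ico 1 n, μ.real (Bl l n A A1 A2 ∩ {ω | |R1 ω 0 j| ∉ A1}) = 0 := by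
    refine Finset.sum_eq_zero fun j hj => ?_
    have : Bl l n A A1 A2 ∩ {ω | |R1 ω 0 j| ∉ A1} = ∅ := by
      ext ω
      simp only [Finset.mem_Ico] at hj
      simp only [Bl, E1, Set.mem_inter_iff, Set.mem_setOf_eq, Set.mem_empty_iff_false, iff_false]
      rintro ⟨⟨⟨-, h⟩, -⟩, h'⟩
      exact h' (h 0 j (by omega) hj.2 (by omega))
    simp [this]
  rw [h0] at key
  simpa using key

lemma gg_swap (μ : Measure OA) (hsetup : Setup μ)
    (n : ℕ) (l : ℕ) (hl : l < n) (A A1 A2 T : Set ℝ)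
    (hA : MeasurableSet A) (hA1 : MeasurableSet A1) (hA2 : MeasurableSet A2)
    (hT : MeasurableSet T) :
    μ.real (Bl 0 n A A1 A2 ∩ {ω | |R1 ω l n| ∈ T})
      = μ.real (Bl l n A A1 A2 ∩ {ω | |R1 ω 0 n| ∈ T}) := by
  have hfin : {x | (Equiv.swap 0 l) x ≠ x}.Finite := by
    refine (Set.toFinite {0, l}).subset fun x hx => ?_
    by_contra h
    simp only [Set.mem_insert_iff, Set.mem_singleton_iff, not_or] at h
    exact hx (Equiv.swap_apply_of_ne_of_ne h.1 h.2)
  have h := hsetup.exch (Equiv.swap 0 l) 1 hfin (by simp)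
  have hm : Measurable (permMap (Equiv.swap 0 l) 1) := by
    unfold permMap R1 R2 R; fun_prop
  have hms : MeasurableSet (Bl 0 n A A1 A2 ∩ {ω | |R1 ω l n| ∈ T}) :=
    (meas_Bl 0 n hA hA1 hA2).inter ((continuous_abs.measurable.comp (meas_R1 l n)) hT)
  conv_lhs => rw [← h]
  rw [map_measureReal_apply hm hms]
  congr 1
  have hs : ∀ i, i < n → Equiv.swap 0 l i < n := by
    intro i hi
    rw [Equiv.swap_apply_def]; split_ifs <;> omega
  have hnn : Equiv.swap 0 l n = n := Equiv.swap_apply_of_ne_of_ne (by omega) (by omega)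
  ext ω
  have hE : permMap (Equiv.swap 0 l) 1 ω ∈ E1 n A1 ↔ ω ∈ E1 n A1 := by
    simp only [E1, Set.mem_setOf_eq, permMap, R1]
    constructor
    · intro h i j hi hj hij
      have := h _ _ (hs i hi) (hs j hj) (fun e => hij ((Equiv.swap 0 l).injective e))
      simpa using this
    · intro h i j hi hj hij
      exact h _ _ (hs i hi) (hs j hj) (fun e => hij ((Equiv.swap 0 l).injective e))
  simp only [Bl, Set.mem_preimage, Set.mem_inter_iff, hE]
  simp [E2, permMap, R1, R2, R, hnn]

end OverlapArray

/-- In the overlap array setup, if `μ` satisfies the Ghirlanda–Guerra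
identities for system 1, then for every `n ≥ 1` and all Borel sets `A ⊆ [-1,1]`,
`A₁, A₂ ⊆ [0,1]`, one has `μ(C_n) ≥ μ₁(A₁) · μ(B_n)`. -/
theorem statement_8 (μ : Measure OA) (hsetup : Setup μ) (hGG : GG1 μ)
    (n : ℕ) (hn : 1 ≤ n) (A A1 A2 : Set ℝ)
    (hA : MeasurableSet A) (hA1 : MeasurableSet A1) (hA2 : MeasurableSet A2)
    (hAsub : A ⊆ Set.Icc (-1) 1) (hA1sub : A1 ⊆ Set.Icc 0 1) (hA2sub : A2 ⊆ Set.Icc 0 1) :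
    μ (Cev n A A1 A2) ≥ μ {ω | |R1 ω 0 1| ∈ A1} * μ (Bev n A A1 A2) := by
  classical
  haveI := hsetup.prob
  have hB : Bev n A A1 A2 = Bl 0 n A A1 A2 := rfl
  set B := Bev n A A1 A2 with hBdef
  have hmB : MeasurableSet B := hB ▸ meas_Bl 0 n hA hA1 hA2
  have hterm : ∀ l ∈ Finset.range n, μ.real (B ∩ {ω | |R1 ω l n| ∉ A1})
      = (1 / n) * μ.real B * μ.real {ω | |R1 ω 0 1| ∉ A1} := by
    intro l hl
    have hl := Finset.mem_range.1 hl
    have h1 := gg_swap μ hsetup n l hl A A1 A2 A1ᶜ hA hA1 hA2 hA1.compl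
    have h2 := gg_Bl μ hsetup hGG n l hl A A1 A2 hA hA1 hA2
    have h3 := gg_swap μ hsetup n l hl A A1 A2 Set.univ hA hA1 hA2 MeasurableSet.univ
    simp only [Set.mem_univ, Set.setOf_true, Set.inter_univ] at h3
    rw [hB, h3, ← h2]
    exact h1
  have hcover : B ≤ᵐ[μ] (Cev n A A1 A2 ∪ ⋃ l ∈ Finset.range n, (B ∩ {ω | |R1 ω l n| ∉ A1}) : Set OA) := by
    filter_upwards [hsetup.symm] with ω hs hω
    by_cases h : ∃ l, l < n ∧ |R1 ω l n| ∉ A1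
    · obtain ⟨l, hl, h⟩ := h
      right
      simp only [Set.mem_iUnion]
      exact ⟨l, Finset.mem_range.2 hl, hω, h⟩
    · left
      push Not at h
      obtain ⟨⟨ha, h1⟩, h2⟩ := hω
      refine ⟨⟨ha, ?_⟩, h2⟩
      intro i j hi hj hij
      rcases Nat.lt_succ_iff_lt_or_eq.1 hi with hi | rfl
      · rcases Nat.lt_succ_iff_lt_or_eq.1 hj with hj | rfl
        · exact h1 i j hi hj hij
        · exact h i hi
      · rw [(hs i j).1]
        exact h j (by omega)
  have hle : μ.real B ≤ μ.real (Cev n A A1 A2)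
      + μ.real B * μ.real {ω | |R1 ω 0 1| ∉ A1} := by
    have h1 : μ.real B ≤ μ.real (Cev n A A1 A2 ∪ ⋃ l ∈ Finset.range n, (B ∩ {ω | |R1 ω l n| ∉ A1})) :=
      ENNReal.toReal_mono (measure_ne_top _ _) (measure_mono_ae hcover)
    have h2 := measureReal_union_le (μ := μ) (Cev n A A1 A2)
      (⋃ l ∈ Finset.range n, (B ∩ {ω | |R1 ω l n| ∉ A1}))
    have h3 := measureReal_biUnion_finset_le (μ := μ) (Finset.range n)
      (fun l => B ∩ {ω | |R1 ω l n| ∉ A1})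
    rw [Finset.sum_congr rfl hterm, Finset.sum_const, Finset.card_range, nsmul_eq_mul] at h3
    have hn0 : (n : ℝ) ≠ 0 := by positivity
    have h4 : (n : ℝ) * (1 / n * μ.real B * μ.real {ω | |R1 ω 0 1| ∉ A1})
        = μ.real B * μ.real {ω | |R1 ω 0 1| ∉ A1} := by field_simp
    linarith
  have hc : μ.real {ω | |R1 ω 0 1| ∉ A1} = 1 - μ.real {ω | |R1 ω 0 1| ∈ A1} := by
    have : MeasurableSet {ω : OA | |R1 ω 0 1| ∈ A1} :=
      (continuous_abs.measurable.comp (meas_R1 0 1)) hA1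
    rw [← probReal_compl_eq_one_sub this]
    rfl
  rw [hc] at hle
  rw [ge_iff_le, ← ENNReal.toReal_le_toReal (by finiteness) (by finiteness), ENNReal.toReal_mul]
  change μ.real _ * μ.real B ≤ μ.real _
  linarith
end

section
/- In the overlap array setup, suppose μ satisfies the Ghirlanda–Guerra identities for system 1, and take A₂ = [0,1]. Then for every n ≥ 1 and all Borel sets A ⊆ [−1,1], A₁ ⊆ [0,1], one has μ(C_n) ≥ μ₁(A₁)^n · μ_{1,2}(A). -/
open MeasureTheory

open OverlapArray

namespace OverlapArray

lemma meas_permMap (π π' : Equiv.Perm ℕ) : Measurable (permMap π π') := by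
  unfold permMap R1 R2 R; fun_prop

/-- `{R_{l,1} ∈ A} ∩ E1 n`. -/
def Tl (l n : ℕ) (A A1 : Set ℝ) : Set OA := {ω | R ω l 0 ∈ A} ∩ E1 n A1

lemma meas_Tl (l n : ℕ) {A A1 : Set ℝ} (hA : MeasurableSet A) (hA1 : MeasurableSet A1) :
    MeasurableSet (Tl l n A A1) := by
  refine (meas_R l 0 hA).inter ?_
  have : E1 n A1 = ⋂ (i : ℕ) (j : ℕ) (_ : i < n) (_ : j < n) (_ : i ≠ j),
      {ω | |R1 ω i j| ∈ A1} := by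
    ext ω; simp [E1]
  rw [this]
  refine MeasurableSet.iInter fun i => MeasurableSet.iInter fun j => MeasurableSet.iInter fun _ =>
    MeasurableSet.iInter fun _ => MeasurableSet.iInter fun _ => ?_
  exact (meas_R1 i j).abs hA1

lemma meas_bad (i j : ℕ) {A1 : Set ℝ} (hA1 : MeasurableSet A1) :
    MeasurableSet {ω : OA | |R1 ω i j| ∉ A1} :=
  ((meas_R1 i j).abs hA1).compl

lemma swap_lt {l n i : ℕ} (hl : l < n) (hi : i < n) : Equiv.swap 0 l i < n := by
  rw [Equiv.swap_apply_def]; split_ifs <;> omega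

lemma pre_Tl {l n : ℕ} (hl : l < n) (A A1 : Set ℝ) :
    permMap (Equiv.swap 0 l) (Equiv.refl ℕ) ⁻¹' (Tl 0 n A A1) = Tl l n A A1 := by
  ext ω
  simp only [Tl, E1, permMap, R1, R, Set.mem_preimage, Set.mem_inter_iff, Set.mem_ofPred_eq,
    Equiv.swap_apply_left, Equiv.refl_apply]
  refine and_congr_right fun _ => ⟨fun h i j hi hj hij => ?_, fun h i j hi hj hij => ?_⟩
  · have := h (Equiv.swap 0 l i) (Equiv.swap 0 l j) (swap_lt hl hi) (swap_lt hl hj)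
      (fun e => hij ((Equiv.swap 0 l).injective e))
    simpa using this
  · exact h _ _ (swap_lt hl hi) (swap_lt hl hj) (fun e => hij ((Equiv.swap 0 l).injective e))

lemma pre_bad {l n : ℕ} (hl : l < n) (A1 : Set ℝ) :
    permMap (Equiv.swap 0 l) (Equiv.refl ℕ) ⁻¹' {ω | |R1 ω l n| ∉ A1} =
      {ω | |R1 ω 0 n| ∉ A1} := by
  ext ω
  have : Equiv.swap 0 l n = n := Equiv.swap_apply_of_ne_of_ne (by omega) (by omega)
  simp [permMap, R1, this]

lemma swap_meas {μ : Measure OA} (hs : Setup μ) (l : ℕ) {S : Set OA} (hS : MeasurableSet S) :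
    μ.real (permMap (Equiv.swap 0 l) (Equiv.refl ℕ) ⁻¹' S) = μ.real S := by
  have h := hs.exch (Equiv.swap 0 l) (Equiv.refl ℕ)
    ((Set.toFinite {0, l}).subset (by
      intro x hx
      by_contra hc
      simp only [Set.mem_insert_iff, Set.mem_singleton_iff, not_or] at hc
      exact hx (Equiv.swap_apply_of_ne_of_ne hc.1 hc.2))) (by simp)
  conv_rhs => rw [← h]
  rw [measureReal_def, measureReal_def, Measure.map_apply (meas_permMap _ _) hS]

lemma gg_bad {μ : Measure OA} (hs : Setup μ) (hGG : GG1 μ) {l n : ℕ} (hl : l < n)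
    {A A1 : Set ℝ} (hA : MeasurableSet A) (hA1 : MeasurableSet A1) :
    n * μ.real (Tl 0 n A A1 ∩ {ω | |R1 ω l n| ∉ A1}) =
      (1 - μ.real {ω | |R1 ω 0 1| ∈ A1}) * μ.real (Tl 0 n A A1) := by
  have := hs.prob
  rw [← swap_meas hs l ((meas_Tl 0 n hA hA1).inter (meas_bad l n hA1)), Set.preimage_inter,
    pre_Tl hl, pre_bad hl, ← swap_meas hs l (meas_Tl 0 n hA hA1), pre_Tl hl]
  have hn : 1 ≤ n := by omega
  let F : Set ((Fin n → Fin n → ℝ) × (Fin n → Fin n → ℝ) × (Fin n → Fin n → ℝ)) :=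
    {v | v.2.2 ⟨l, hl⟩ ⟨0, hn⟩ ∈ A} ∩ ⋂ (i : Fin n) (j : Fin n) (_ : i ≠ j), {v | |v.1 i j| ∈ A1}
  have hF : MeasurableSet F := by
    refine MeasurableSet.inter ?_ (MeasurableSet.iInter fun i => MeasurableSet.iInter fun j =>
      MeasurableSet.iInter fun _ => ?_)
    · exact (show Measurable (fun v : (Fin n → Fin n → ℝ) × (Fin n → Fin n → ℝ) ×
        (Fin n → Fin n → ℝ) => v.2.2 ⟨l, hl⟩ ⟨0, hn⟩) by fun_prop) hA
    · exact (show Measurable (fun v : (Fin n → Fin n → ℝ) × (Fin n → Fin n → ℝ) ×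
        (Fin n → Fin n → ℝ) => |v.1 i j|) from Measurable.abs (by fun_prop)) hA1
  let P : Set ℝ := {x | |x| ∉ A1}
  have hP : MeasurableSet P := ((measurable_id.abs) hA1).compl
  have hb : ∀ {α : Type} (s : Set α) (x : α), |s.indicator (fun _ => (1 : ℝ)) x| ≤ 1 := by
    intro α s x
    by_cases hx : x ∈ s <;> simp [hx]
  have h := hGG n hn (F.indicator fun _ => 1) (measurable_const.indicator hF) ⟨1, hb F⟩
    (P.indicator fun _ => 1) (measurable_const.indicator hP) ⟨1, hb P⟩ (by
      intro x
      have e : -x ∈ P ↔ x ∈ P := by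
        change |(-x)| ∉ A1 ↔ |x| ∉ A1
        rw [abs_neg]
      by_cases hx : x ∈ P
      · rw [Set.indicator_of_mem hx, Set.indicator_of_mem (e.2 hx)]
      · rw [Set.indicator_of_notMem hx, Set.indicator_of_notMem (fun c => hx (e.1 c))])
  have hf : fRep n (F.indicator fun _ => 1) = (Tl l n A A1).indicator fun _ => 1 := by
    ext ω
    simp only [fRep, Set.indicator]
    congr 1
    simp only [F, Tl, E1, Set.mem_inter_iff, Set.mem_ofPred_eq, Set.mem_iInter, eq_iff_iff]
    refine and_congr_right fun _ => ⟨fun h i j hi hj hij => ?_, fun h i j hij => ?_⟩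
    · exact h ⟨i, hi⟩ ⟨j, hj⟩ (by simpa using hij)
    · exact h i j i.2 j.2 (fun e => hij (Fin.ext e))
  have hprod : ∀ k, (fun ω => (Tl l n A A1).indicator (fun _ => (1:ℝ)) ω *
      P.indicator (fun _ => (1:ℝ)) (R1 ω 0 k)) =
      (Tl l n A A1 ∩ {ω | |R1 ω 0 k| ∉ A1}).indicator fun _ => 1 := by
    intro k; ext ω
    simp only [Set.indicator, P, Set.mem_inter_iff, Set.mem_ofPred_eq]
    split_ifs <;> simp_all
  have hψ : (fun ω => P.indicator (fun _ => (1:ℝ)) (R1 ω 0 1)) =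
      {ω : OA | |R1 ω 0 1| ∉ A1}.indicator fun _ => 1 := by
    ext ω; simp [Set.indicator, P]
  have hint : ∀ {S : Set OA}, MeasurableSet S →
      ∫ ω, S.indicator (fun _ => (1:ℝ)) ω ∂μ = μ.real S := by
    intro S hS
    rw [integral_indicator hS]; simp
  have hT := meas_Tl l n hA hA1
  rw [hf] at h
  simp only [hprod, hψ] at h
  rw [hint (hT.inter (meas_bad 0 n hA1)), hint hT, hint (meas_bad 0 1 hA1),
    Finset.sum_eq_zero, show {ω : OA | |R1 ω 0 1| ∉ A1} = {ω : OA | |R1 ω 0 1| ∈ A1}ᶜ from rfl,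
    probReal_compl_eq_one_sub (s := {ω : OA | |R1 ω 0 1| ∈ A1}) ((meas_R1 0 1).abs hA1)] at h
  · have hn0 : (n : ℝ) ≠ 0 := by positivity
    rw [h]; field_simp; ring
  · intro k hk
    rw [hint (hT.inter (meas_bad 0 k hA1))]
    rw [Finset.mem_Ico] at hk
    have : Tl l n A A1 ∩ {ω : OA | |R1 ω 0 k| ∉ A1} = ∅ := by
      ext ω
      simp only [Set.mem_inter_iff, Set.mem_ofPred_eq, Set.mem_empty_iff_false, iff_false, not_and,
        not_not]
      exact fun hω => hω.2 0 k (by omega) hk.2 (by omega)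
    rw [this]; simp

lemma step {μ : Measure OA} (hs : Setup μ) (hGG : GG1 μ) {n : ℕ} (hn : 1 ≤ n)
    {A A1 : Set ℝ} (hA : MeasurableSet A) (hA1 : MeasurableSet A1) :
    μ.real {ω | |R1 ω 0 1| ∈ A1} * μ.real (Tl 0 n A A1) ≤ μ.real (Tl 0 (n+1) A A1) := by
  have := hs.prob
  set p := μ.real {ω | |R1 ω 0 1| ∈ A1}
  have hn0 : (n : ℝ) ≠ 0 := by positivity
  have h1 : μ (Tl 0 n A A1) ≤ μ (Tl 0 (n+1) A A1 ∪
      ⋃ l ∈ Finset.range n, (Tl 0 n A A1 ∩ {ω | |R1 ω l n| ∉ A1})) := by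
    refine measure_mono_ae ?_
    filter_upwards [hs.symm] with ω hsym
    intro hω
    by_cases hc : ∃ l < n, |R1 ω l n| ∉ A1
    · obtain ⟨l, hl, hb⟩ := hc
      refine Or.inr ?_
      simp only [Set.mem_iUnion]
      exact ⟨l, Finset.mem_range.2 hl, hω, hb⟩
    · push Not at hc
      refine Or.inl ⟨hω.1, fun i j hi hj hij => ?_⟩
      rcases Nat.lt_succ_iff_lt_or_eq.1 hi with hi | rfl
      · rcases Nat.lt_succ_iff_lt_or_eq.1 hj with hj | rfl
        · exact hω.2 i j hi hj hij
        · exact hc i hi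
      · rw [(hsym i j).1]
        exact hc j (by omega)
  have h2 : μ.real (Tl 0 n A A1) ≤ μ.real (Tl 0 (n+1) A A1) +
      ∑ l ∈ Finset.range n, μ.real (Tl 0 n A A1 ∩ {ω | |R1 ω l n| ∉ A1}) :=
    (ENNReal.toReal_mono (measure_ne_top _ _) h1).trans ((measureReal_union_le _ _).trans
      (add_le_add le_rfl (measureReal_biUnion_finset_le _ _)))
  have h3 : ∑ l ∈ Finset.range n, μ.real (Tl 0 n A A1 ∩ {ω | |R1 ω l n| ∉ A1}) =
      (1 - p) * μ.real (Tl 0 n A A1) := by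
    rw [Finset.sum_congr rfl (g := fun _ => (1 - p) * μ.real (Tl 0 n A A1) / n)]
    · rw [Finset.sum_const, Finset.card_range, nsmul_eq_mul]; field_simp
    · intro l hl
      rw [← gg_bad hs hGG (Finset.mem_range.1 hl) hA hA1]; field_simp
  rw [h3] at h2
  linarith

end OverlapArray

/-- In the overlap array setup, if `μ` satisfies the Ghirlanda–Guerra
identities for system 1 and `A₂ = [0,1]`, then for every `n ≥ 1` and all Borel sets
`A ⊆ [-1,1]`, `A₁ ⊆ [0,1]`, one has `μ(C_n) ≥ μ₁(A₁)^n · μ_{1,2}(A)`. -/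
theorem statement_10 (μ : Measure OA) (hsetup : Setup μ) (hGG : GG1 μ)
    (n : ℕ) (hn : 1 ≤ n) (A A1 : Set ℝ)
    (hA : MeasurableSet A) (hA1 : MeasurableSet A1)
    (hAsub : A ⊆ Set.Icc (-1) 1) (hA1sub : A1 ⊆ Set.Icc 0 1) :
    μ (Cev n A A1 (Set.Icc 0 1)) ≥ μ {ω | |R1 ω 0 1| ∈ A1} ^ n * μ {ω | R ω 0 0 ∈ A} := by
  have := hsetup.prob
  have key : ∀ n : ℕ, μ.real {ω | |R1 ω 0 1| ∈ A1} ^ n * μ.real {ω | R ω 0 0 ∈ A} ≤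
      μ.real (Tl 0 (n+1) A A1) := by
    intro n
    induction n with
    | zero =>
      have : Tl 0 (0+1) A A1 = {ω | R ω 0 0 ∈ A} := by
        ext ω
        simp only [Tl, E1, Set.mem_inter_iff, Set.mem_ofPred_eq, and_iff_left_iff_imp]
        intro _ i j hi hj hij
        omega
      rw [this]; simp
    | succ n ih =>
      refine le_trans ?_ (step hsetup hGG (by omega) hA hA1)
      rw [pow_succ', mul_assoc]
      exact mul_le_mul_of_nonneg_left ih measureReal_nonneg
  have h1 : μ (Tl 0 (n+1) A A1) ≤ μ (Cev n A A1 (Set.Icc 0 1)) := by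
    refine measure_mono_ae ?_
    filter_upwards [hsetup.bounded] with ω hb hω
    exact ⟨hω, fun i j _ _ _ => ⟨abs_nonneg _, (hb i j).2.1⟩⟩
  refine ge_iff_le.2 (le_trans ?_ h1)
  rw [← ENNReal.toReal_le_toReal (ENNReal.mul_ne_top (ENNReal.pow_ne_top (measure_ne_top _ _))
    (measure_ne_top _ _)) (measure_ne_top _ _), ENNReal.toReal_mul, ENNReal.toReal_pow]
  exact key n
end

section
/- In the overlap array setup, let p ≥ 2 be an even integer, and suppose μ satisfies the Ψ-identities for system 1 and the Ψ-identities for system 2 with the function ψ(x) = x^p. Then μ( |R_{l,l'}| = |R_{1,1}| for all l, l' ≥ 1 ) = 1. -/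
open MeasureTheory

namespace OverlapArray

/-- The Ψ-identities for system 1 with function `ψ`: for every `n ≥ 1` and every bounded
measurable function `f` of the overlaps on `n` replicas,
`E[f·ψ(R_{1,n+1})] = (1/n) ∑_{l=1}^n E[f·ψ(R_{1,l})]`
(replicas are indexed from `0` here). -/
def Psi1Id (μ : MeasureTheory.Measure OA) (ψ : ℝ → ℝ) : Prop :=
  ∀ n : ℕ, 1 ≤ n →
  ∀ f : ((Fin n → Fin n → ℝ) × (Fin n → Fin n → ℝ) × (Fin n → Fin n → ℝ)) → ℝ,
    Measurable f → (∃ C, ∀ v, |f v| ≤ C) →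
    ∫ ω, fRep n f ω * ψ (R ω 0 n) ∂μ
      = (1 / n) * ∑ l ∈ Finset.range n, ∫ ω, fRep n f ω * ψ (R ω 0 l) ∂μ

/-- The Ψ-identities for system 2 with function `ψ`: for every `n ≥ 1` and every bounded
measurable function `f` of the overlaps on `n` replicas,
`E[f·ψ(R_{n+1,1})] = (1/n) ∑_{l=1}^n E[f·ψ(R_{l,1})]`. -/
def Psi2Id (μ : MeasureTheory.Measure OA) (ψ : ℝ → ℝ) : Prop :=
  ∀ n : ℕ, 1 ≤ n →
  ∀ f : ((Fin n → Fin n → ℝ) × (Fin n → Fin n → ℝ) × (Fin n → Fin n → ℝ)) → ℝ,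
    Measurable f → (∃ C, ∀ v, |f v| ≤ C) →
    ∫ ω, fRep n f ω * ψ (R ω n 0) ∂μ
      = (1 / n) * ∑ l ∈ Finset.range n, ∫ ω, fRep n f ω * ψ (R ω l 0) ∂μ

end OverlapArray

open OverlapArray

lemma aux_eq {α : Type*} [MeasurableSpace α] (μ : Measure α) [IsProbabilityMeasure μ]
    (X Y : α → ℝ) (hX : Measurable X) (hY : Measurable Y)
    (hXb : ∀ᵐ ω ∂μ, |X ω| ≤ 1) (hYb : ∀ᵐ ω ∂μ, |Y ω| ≤ 1)
    (h1 : ∫ ω, X ω * Y ω ∂μ = ∫ ω, X ω * X ω ∂μ)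
    (h2 : ∫ ω, Y ω * Y ω ∂μ = ∫ ω, X ω * X ω ∂μ) : ∀ᵐ ω ∂μ, X ω = Y ω := by
  have key : ∀ U V : α → ℝ, Measurable U → Measurable V → (∀ᵐ ω ∂μ, |U ω| ≤ 1) →
      (∀ᵐ ω ∂μ, |V ω| ≤ 1) → Integrable (fun ω => U ω * V ω) μ := by
    intro U V hU hV hUb hVb
    refine Integrable.of_bound (hU.mul hV).aestronglyMeasurable 1 ?_
    filter_upwards [hUb, hVb] with ω a b
    rw [Real.norm_eq_abs, abs_mul]
    exact mul_le_one₀ a (abs_nonneg _) b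
  have iXX := key X X hX hX hXb hXb
  have iXY := key X Y hX hY hXb hYb
  have iYY := key Y Y hY hY hYb hYb
  have e : (fun ω => (X ω - Y ω) ^ 2) =
      fun ω => (X ω * X ω - 2 * (X ω * Y ω)) + Y ω * Y ω := by
    funext ω; ring
  have i2 : Integrable (fun ω => X ω * X ω - 2 * (X ω * Y ω)) μ := iXX.sub (iXY.const_mul 2)
  have iD : Integrable (fun ω => (X ω - Y ω) ^ 2) μ := by
    rw [e]; exact i2.add iYY
  have z : ∫ ω, (X ω - Y ω) ^ 2 ∂μ = 0 := by
    rw [e, integral_add i2 iYY, integral_sub iXX (iXY.const_mul 2), integral_const_mul, h1, h2]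
    ring
  have := (integral_eq_zero_iff_of_nonneg (fun ω => sq_nonneg (X ω - Y ω)) iD).1 z
  filter_upwards [this] with ω h
  have h' : (X ω - Y ω) ^ 2 = 0 := h
  exact sub_eq_zero.1 (pow_eq_zero_iff (two_ne_zero) |>.1 h')

lemma measurable_R (i j : ℕ) : Measurable (fun ω : OA => R ω i j) := by
  unfold R; fun_prop

lemma measurable_permMap (π π' : Equiv.Perm ℕ) : Measurable (permMap π π') := by
  unfold permMap R R1 R2; fun_prop

lemma swap_finite (a b : ℕ) : {x | Equiv.swap a b x ≠ x}.Finite := by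
  refine Set.Finite.subset (Set.toFinite {a, b}) ?_
  intro x hx
  by_contra h
  simp only [Set.mem_insert_iff, Set.mem_singleton_iff, not_or] at h
  exact hx (Equiv.swap_apply_of_ne_of_ne h.1 h.2)

lemma ae_swap {μ : Measure OA} (hs : Setup μ) (a b c d : ℕ) {P : OA → Prop}
    (h : ∀ᵐ ω ∂μ, P ω) : ∀ᵐ ω ∂μ, P (permMap (Equiv.swap a b) (Equiv.swap c d) ω) := by
  rw [← hs.exch _ _ (swap_finite a b) (swap_finite c d)] at h
  exact ae_of_ae_map (measurable_permMap _ _).aemeasurable h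

lemma integral_swap {μ : Measure OA} (hs : Setup μ) (a b c d : ℕ) {F : OA → ℝ}
    (hF : Measurable F) :
    ∫ ω, F (permMap (Equiv.swap a b) (Equiv.swap c d) ω) ∂μ = ∫ ω, F ω ∂μ := by
  conv_rhs => rw [← hs.exch _ _ (swap_finite a b) (swap_finite c d)]
  rw [integral_map (measurable_permMap _ _).aemeasurable hF.aestronglyMeasurable]

lemma step {μ : Measure OA} (hs : Setup μ) (p : ℕ) (hp : 2 ≤ p) (i j : ℕ)
    (h : ∀ f : ((Fin 1 → Fin 1 → ℝ) × (Fin 1 → Fin 1 → ℝ) × (Fin 1 → Fin 1 → ℝ)) → ℝ,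
      Measurable f → (∃ C, ∀ v, |f v| ≤ C) →
      ∫ ω, fRep 1 f ω * R ω i j ^ p ∂μ = ∫ ω, fRep 1 f ω * R ω 0 0 ^ p ∂μ) :
    ∀ᵐ ω ∂μ, |R ω 0 0| = |R ω i j| := by
  haveI := hs.prob
  have hb : ∀ i j, ∀ᵐ ω ∂μ, |R ω i j ^ p| ≤ 1 := by
    intro i j
    filter_upwards [hs.bounded] with ω hω
    rw [abs_pow]
    exact pow_le_one₀ (abs_nonneg _) (hω i j).2.2
  have hm : ∀ i j, Measurable (fun ω : OA => R ω i j ^ p) := fun i j => (measurable_R i j).pow_const p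
  have h' := h (fun v => max (-1) (min 1 (v.2.2 0 0 ^ p))) (by fun_prop)
    ⟨1, fun v => abs_le.2 ⟨le_max_left _ _, max_le (by norm_num) (min_le_left _ _)⟩⟩
  have hc : ∀ᵐ ω ∂μ, fRep 1 (fun v => max (-1) (min 1 (v.2.2 0 0 ^ p))) ω = R ω 0 0 ^ p := by
    filter_upwards [hb 0 0] with ω hω
    have := abs_le.1 hω
    simp only [fRep, Fin.val_zero]
    rw [min_eq_right this.2, max_eq_right this.1]
  have hcc : ∀ i j, ∫ ω, fRep 1 (fun v => max (-1) (min 1 (v.2.2 0 0 ^ p))) ω * R ω i j ^ p ∂μ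
      = ∫ ω, R ω 0 0 ^ p * R ω i j ^ p ∂μ := by
    intro i j
    apply integral_congr_ae
    filter_upwards [hc] with ω hω
    rw [hω]
  rw [hcc, hcc] at h'
  have hsw := integral_swap hs 0 i 0 j (F := fun ω => R ω 0 0 ^ p * R ω 0 0 ^ p)
    ((hm 0 0).mul (hm 0 0))
  have he : ∀ ω, R (permMap (Equiv.swap 0 i) (Equiv.swap 0 j) ω) 0 0 = R ω i j := by
    intro ω
    show R ω (Equiv.swap 0 i 0) (Equiv.swap 0 j 0) = _
    simp
  simp only [he] at hsw
  filter_upwards [aux_eq μ _ _ (hm 0 0) (hm i j) (hb 0 0) (hb i j) h' hsw] with ω hω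
  have hω' : |R ω 0 0| ^ p = |R ω i j| ^ p := by rw [← abs_pow, ← abs_pow, hω]
  exact (pow_left_inj₀ (abs_nonneg _) (abs_nonneg _) (by omega)).1 hω'

/-- In the overlap array setup, if `p ≥ 2` is even and `μ` satisfies the
Ψ-identities for both systems with `ψ(x) = x^p`, then
`μ(|R_{l,l'}| = |R_{1,1}| for all l,l') = 1`. -/
theorem statement_15 (μ : MeasureTheory.Measure OA) (hsetup : Setup μ)
    (p : ℕ) (hp : 2 ≤ p) (hpeven : Even p)
    (h1 : Psi1Id μ (fun x => x ^ p)) (h2 : Psi2Id μ (fun x => x ^ p)) :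
    μ {ω | ∀ l l', |R ω l l'| = |R ω 0 0|} = 1 := by
  have a1 : ∀ᵐ ω ∂μ, |R ω 0 0| = |R ω 0 1| := by
    refine step hsetup p hp 0 1 fun f hf hC => ?_
    simpa using h1 1 le_rfl f hf hC
  have a2 : ∀ᵐ ω ∂μ, |R ω 0 0| = |R ω 1 0| := by
    refine step hsetup p hp 1 0 fun f hf hC => ?_
    simpa using h2 1 le_rfl f hf hC
  have b1 : ∀ l l', ∀ᵐ ω ∂μ, |R ω l l'| = |R ω l 0| := by
    intro l l'
    rcases Nat.eq_zero_or_pos l' with rfl | hl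
    · exact Filter.Eventually.of_forall fun _ => rfl
    filter_upwards [ae_swap hsetup 0 l 1 l' a1] with ω hω
    have hω' : |R ω (Equiv.swap 0 l 0) (Equiv.swap 1 l' 0)|
      = |R ω (Equiv.swap 0 l 0) (Equiv.swap 1 l' 1)| := hω
    rw [Equiv.swap_apply_left, Equiv.swap_apply_left,
      Equiv.swap_apply_of_ne_of_ne (by omega) (by omega)] at hω'
    exact hω'.symm
  have b2 : ∀ l, ∀ᵐ ω ∂μ, |R ω l 0| = |R ω 0 0| := by
    intro l
    rcases Nat.eq_zero_or_pos l with rfl | hl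
    · exact Filter.Eventually.of_forall fun _ => rfl
    filter_upwards [ae_swap hsetup 1 l 0 0 a2] with ω hω
    have hω' : |R ω (Equiv.swap 1 l 0) (Equiv.swap 0 0 0)|
      = |R ω (Equiv.swap 1 l 1) (Equiv.swap 0 0 0)| := hω
    rw [Equiv.swap_apply_left, Equiv.swap_apply_left,
      Equiv.swap_apply_of_ne_of_ne (by omega) (by omega)] at hω'
    exact hω'.symm
  haveI := hsetup.prob
  have hall : ∀ᵐ ω ∂μ, ∀ l l', |R ω l l'| = |R ω 0 0| := by
    rw [ae_all_iff]; intro l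
    rw [ae_all_iff]; intro l'
    filter_upwards [b1 l l', b2 l] with ω u v
    rw [u, v]
  rw [measure_eq_measure_of_null_diff (Set.subset_univ _) ?_, measure_univ]
  rw [← Set.compl_eq_univ_diff]
  exact hall
end
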